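/- arXiv:math/0307145 — 2 statements merged into one kernel-verified Lean document; each statement's English description precedes it below -/
import Mathlib

section
/- Let (A,C) be a measuring α-pairing with A unital and separable, i.e. A is projective as a left module over its enveloping algebra A^e = A⊗_R A^{op}. Then a right C-comodule M is coflat (the functor M□_C −: {}^C M → M_R is exact) if and only if M is flat as an R-module. -/
open TensorProduct

universe u

/-- The canonical map `α^P_M : M ⊗ C → Hom(A, M)` associated to an `R`-pairing
`β : A → C → R`, sending `Σ mᵢ ⊗ cᵢ` to `a ↦ Σ ⟨a, cᵢ⟩ • mᵢ`. -/
noncomputable def alphaMap (R : Type u) [CommRing R]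
    {A : Type u} [AddCommGroup A] [Module R A]
    {C : Type u} [AddCommGroup C] [Module R C]
    (β : A →ₗ[R] C →ₗ[R] R)
    (M : Type u) [AddCommGroup M] [Module R M] :
    (M ⊗[R] C) →ₗ[R] (A →ₗ[R] M) :=
  (dualTensorHom R A M) ∘ₗ
    (TensorProduct.comm R M (Module.Dual R A)).toLinearMap ∘ₗ
    (TensorProduct.map LinearMap.id β.flip)

/-- `(A, C)` is a measuring pairing: `κ_P : A → C*` is multiplicative into the
convolution algebra `C*`. -/
def IsMeasuring (R : Type u) [CommRing R]
    {A : Type u} [NonUnitalRing A] [Module R A]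
    {C : Type u} [AddCommGroup C] [Module R C] [Coalgebra R C]
    (β : A →ₗ[R] C →ₗ[R] R) : Prop :=
  ∀ a b : A,
    β (a * b) =
      (LinearMap.mul' R R) ∘ₗ (TensorProduct.map (β a) (β b)) ∘ₗ
        (Coalgebra.comul (R := R) (A := C))

/-- The rational submodule `Rat^C(M)` of a module with `A`-action `σ`. -/
noncomputable def ratSubmodule (R : Type u) [CommRing R]
    {A : Type u} [AddCommGroup A] [Module R A]
    {C : Type u} [AddCommGroup C] [Module R C]
    (β : A →ₗ[R] C →ₗ[R] R)
    {M : Type u} [AddCommGroup M] [Module R M]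
    (σ : A →ₗ[R] M →ₗ[R] M) : Submodule R M :=
  (LinearMap.range (alphaMap R β M)).comap σ.flip

/-- The `A`-action induced on a right `C`-comodule: `a • m = Σ m₍₀₎⟨a, m₍₁₎⟩`. -/
noncomputable def inducedAction (R : Type u) [CommRing R]
    {A : Type u} [AddCommGroup A] [Module R A]
    {C : Type u} [AddCommGroup C] [Module R C]
    (β : A →ₗ[R] C →ₗ[R] R)
    {M : Type u} [AddCommGroup M] [Module R M]
    (ϱ : M →ₗ[R] M ⊗[R] C) : A →ₗ[R] M →ₗ[R] M :=
  ((alphaMap R β M) ∘ₗ ϱ).flip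

/-- `ϱ : M → M ⊗ C` is a (coassociative, counital) right `C`-comodule structure. -/
def IsRightComodule (R : Type u) [CommRing R]
    {C : Type u} [AddCommGroup C] [Module R C] [Coalgebra R C]
    {M : Type u} [AddCommGroup M] [Module R M]
    (ϱ : M →ₗ[R] M ⊗[R] C) : Prop :=
  ((TensorProduct.assoc R M C C).toLinearMap ∘ₗ (TensorProduct.map ϱ LinearMap.id) ∘ₗ ϱ
      = (TensorProduct.map LinearMap.id (Coalgebra.comul (R := R))) ∘ₗ ϱ)
  ∧ ∀ m : M,
      (TensorProduct.rid R M)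
        ((TensorProduct.map LinearMap.id (Coalgebra.counit (R := R))) (ϱ m)) = m

/-- `ϱ : N → C ⊗ N` is a (coassociative, counital) left `C`-comodule structure. -/
def IsLeftComodule (R : Type u) [CommRing R]
    {C : Type u} [AddCommGroup C] [Module R C] [Coalgebra R C]
    {N : Type u} [AddCommGroup N] [Module R N]
    (ϱ : N →ₗ[R] C ⊗[R] N) : Prop :=
  ((TensorProduct.assoc R C C N).symm.toLinearMap ∘ₗ (TensorProduct.map LinearMap.id ϱ) ∘ₗ ϱ
      = (TensorProduct.map (Coalgebra.comul (R := R)) LinearMap.id) ∘ₗ ϱ)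
  ∧ ∀ n : N,
      (TensorProduct.lid R N)
        ((TensorProduct.map (Coalgebra.counit (R := R)) LinearMap.id) (ϱ n)) = n

/-- The cotensor product `M □_C N` as a submodule of `M ⊗ N`. -/
noncomputable def cotensor (R : Type u) [CommRing R]
    {C : Type u} [AddCommGroup C] [Module R C]
    {M : Type u} [AddCommGroup M] [Module R M]
    {N : Type u} [AddCommGroup N] [Module R N]
    (ϱM : M →ₗ[R] M ⊗[R] C) (ϱN : N →ₗ[R] C ⊗[R] N) : Submodule R (M ⊗[R] N) :=
  LinearMap.ker
    ((TensorProduct.assoc R M C N).toLinearMap ∘ₗ (TensorProduct.map ϱM LinearMap.id)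
      - (TensorProduct.map LinearMap.id ϱN))

/-- The right `A`-action induced on a left `C`-comodule: `n • a = Σ ⟨a, n₍₋₁₎⟩ n₍₀₎`. -/
noncomputable def rAct (R : Type u) [CommRing R]
    {A : Type u} [AddCommGroup A] [Module R A]
    {C : Type u} [AddCommGroup C] [Module R C]
    {N : Type u} [AddCommGroup N] [Module R N]
    (β : A →ₗ[R] C →ₗ[R] R) (ϱ : N →ₗ[R] C ⊗[R] N) (a : A) : N →ₗ[R] N :=
  (TensorProduct.lid R N).toLinearMap ∘ₗ (TensorProduct.map (β a) LinearMap.id) ∘ₗ ϱ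

/-- `Hom_{A-}(B, N)`: the `A`-linear maps `B → N`, where `B` is an `A`-module via `ξ`. -/
noncomputable def homA (R : Type u) [CommRing R]
    {A B N : Type u} [Ring A] [Algebra R A] [Ring B] [Algebra R B]
    [AddCommGroup N] [Module R N]
    (ξ : A →ₐ[R] B) (σN : A →ₗ[R] N →ₗ[R] N) : Submodule R (B →ₗ[R] N) where
  carrier := {f | ∀ (a : A) (b : B), f (ξ a * b) = σN a (f b)}
  zero_mem' := by intro a b; simp
  add_mem' := by intro f g hf hg a b; simp [hf a b, hg a b]
  smul_mem' := by intro r f hf a b; simp [hf a b]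

/-- Evaluation at `1_B` as a linear map on a submodule of `Hom_R(B, N)`. -/
noncomputable def evalAtOne {R B N : Type u} [CommRing R] [Ring B] [Algebra R B]
    [AddCommGroup N] [Module R N] (Hsub : Submodule R (B →ₗ[R] N)) : ↥Hsub →ₗ[R] N where
  toFun f := (f : B →ₗ[R] N) 1
  map_add' f g := by simp
  map_smul' r f := by simp

/-- A right `C`-comodule `(M, ϱM)` is coflat: the cotensor functor `M □_C −` is exact on
short exact sequences of counital left `C`-comodules. -/
def IsCoflat (R : Type u) [CommRing R]
    {C : Type u} [AddCommGroup C] [Module R C] [Coalgebra R C]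
    {M : Type u} [AddCommGroup M] [Module R M]
    (ϱM : M →ₗ[R] M ⊗[R] C) : Prop :=
  ∀ (N₁ N₂ N₃ : Type u) [AddCommGroup N₁] [Module R N₁] [AddCommGroup N₂] [Module R N₂]
    [AddCommGroup N₃] [Module R N₃],
  ∀ (ϱ₁ : N₁ →ₗ[R] C ⊗[R] N₁) (ϱ₂ : N₂ →ₗ[R] C ⊗[R] N₂) (ϱ₃ : N₃ →ₗ[R] C ⊗[R] N₃),
    IsLeftComodule R ϱ₁ → Function.Injective ϱ₁ →
    IsLeftComodule R ϱ₂ → Function.Injective ϱ₂ →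
    IsLeftComodule R ϱ₃ → Function.Injective ϱ₃ →
    ∀ (f : N₁ →ₗ[R] N₂) (g : N₂ →ₗ[R] N₃),
      (ϱ₂ ∘ₗ f = (TensorProduct.map LinearMap.id f) ∘ₗ ϱ₁) →
      (ϱ₃ ∘ₗ g = (TensorProduct.map LinearMap.id g) ∘ₗ ϱ₂) →
      Function.Injective f → Function.Surjective g →
      LinearMap.range f = LinearMap.ker g →
      -- `M □_C f` is injective,
      ((∀ x ∈ cotensor R ϱM ϱ₁, ∀ y ∈ cotensor R ϱM ϱ₁,
          TensorProduct.map LinearMap.id f x = TensorProduct.map LinearMap.id f y →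
          x = y)
        -- the sequence is exact in the middle,
        ∧ (∀ y ∈ cotensor R ϱM ϱ₂, TensorProduct.map LinearMap.id g y = 0 →
            ∃ x ∈ cotensor R ϱM ϱ₁, TensorProduct.map LinearMap.id f x = y)
        -- and `M □_C g` is surjective
        ∧ (∀ z ∈ cotensor R ϱM ϱ₃,
            ∃ y ∈ cotensor R ϱM ϱ₂, TensorProduct.map LinearMap.id g y = z))

section CotensorRetract

variable {R A C M N : Type u} [CommRing R] [Ring A] [Algebra R A]
  [AddCommGroup C] [Module R C] [AddCommGroup M] [Module R M] [AddCommGroup N] [Module R N]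

lemma alphaMap_tmul (β : A →ₗ[R] C →ₗ[R] R) (m : M) (c : C) (a : A) :
    alphaMap R β M (m ⊗ₜ c) a = β a c • m := by
  simp [alphaMap]

/-- The action on a right comodule, evaluated through the pairing. -/
lemma inducedAction_apply (β : A →ₗ[R] C →ₗ[R] R) (ϱ : M →ₗ[R] M ⊗[R] C) (a : A) (m : M) :
    inducedAction R β ϱ a m = TensorProduct.rid R M (TensorProduct.map LinearMap.id (β a) (ϱ m)) := by
  simp only [inducedAction, LinearMap.flip_apply, LinearMap.comp_apply]
  induction ϱ m with
  | zero => simp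
  | add x y hx hy => simp [hx, hy]
  | tmul x c => simp [alphaMap_tmul]

lemma inducedAction_one [Coalgebra R C] {β : A →ₗ[R] C →ₗ[R] R}
    (hone : β 1 = Coalgebra.counit (R := R)) {ϱ : M →ₗ[R] M ⊗[R] C}
    (hM : IsRightComodule R ϱ) : inducedAction R β ϱ 1 = LinearMap.id := by
  ext m
  rw [inducedAction_apply, hone, hM.2, LinearMap.id_apply]

lemma inducedAction_mul [Coalgebra R C] {β : A →ₗ[R] C →ₗ[R] R} (hmeas : IsMeasuring R β)
    {ϱ : M →ₗ[R] M ⊗[R] C} (hM : IsRightComodule R ϱ) (a b : A) :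
    inducedAction R β ϱ (a * b) = inducedAction R β ϱ a ∘ₗ inducedAction R β ϱ b := by
  have key (t : M ⊗[R] C) :
      inducedAction R β ϱ a (TensorProduct.rid R M (TensorProduct.map LinearMap.id (β b) t)) =
      TensorProduct.rid R M (TensorProduct.map LinearMap.id
        (LinearMap.mul' R R ∘ₗ TensorProduct.map (β a) (β b))
        (TensorProduct.assoc R M C C (TensorProduct.map ϱ LinearMap.id t))) := by
    induction t with
    | zero => simp
    | add x y hx hy => simp only [map_add, hx, hy]
    | tmul m c =>
      simp only [TensorProduct.map_tmul, LinearMap.id_apply, TensorProduct.rid_tmul, map_smul,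
        inducedAction_apply]
      induction ϱ m with
      | zero => simp
      | add x y hx hy => simp only [map_add, smul_add, hx, hy, TensorProduct.add_tmul]
      | tmul m' c' => simp [smul_smul, mul_comm]
  ext m
  have h := congrArg (fun φ => TensorProduct.rid R M (TensorProduct.map LinearMap.id
    (LinearMap.mul' R R ∘ₗ TensorProduct.map (β a) (β b)) (φ m))) hM.1
  simp only [LinearMap.comp_apply, LinearEquiv.coe_coe] at h
  rw [LinearMap.comp_apply, inducedAction_apply β ϱ b, key, h, inducedAction_apply, hmeas a b,
    ← LinearMap.comp_apply (TensorProduct.map _ (_ ∘ₗ _)) (TensorProduct.map _ _),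
    ← TensorProduct.map_comp]
  rfl

/-- The action on a left comodule as a linear map in the algebra argument. -/
noncomputable def rActLinear (β : A →ₗ[R] C →ₗ[R] R) (ϱ : N →ₗ[R] C ⊗[R] N) :
    Aᵐᵒᵖ →ₗ[R] N →ₗ[R] N where
  toFun a := rAct R β ϱ a.unop
  map_add' a b := by ext n; simp [rAct, TensorProduct.map_add_left]
  map_smul' r a := by ext n; simp [rAct, TensorProduct.map_smul_left]

lemma rAct_mul [Coalgebra R C] {β : A →ₗ[R] C →ₗ[R] R} (hmeas : IsMeasuring R β)
    {ϱ : N →ₗ[R] C ⊗[R] N} (hN : IsLeftComodule R ϱ) (a b : A) :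
    rAct R β ϱ (a * b) = rAct R β ϱ b ∘ₗ rAct R β ϱ a := by
  have key (t : C ⊗[R] N) :
      rAct R β ϱ b (TensorProduct.lid R N (TensorProduct.map (β a) LinearMap.id t)) =
      TensorProduct.lid R N (TensorProduct.map
        (LinearMap.mul' R R ∘ₗ TensorProduct.map (β a) (β b)) LinearMap.id
        ((TensorProduct.assoc R C C N).symm (TensorProduct.map LinearMap.id ϱ t))) := by
    induction t with
    | zero => simp
    | add x y hx hy => simp only [map_add, hx, hy]
    | tmul c n =>
      simp only [TensorProduct.map_tmul, LinearMap.id_apply, TensorProduct.lid_tmul, map_smul,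
        rAct, LinearMap.comp_apply, LinearEquiv.coe_coe]
      induction ϱ n with
      | zero => simp
      | add x y hx hy => simp only [map_add, smul_add, hx, hy, TensorProduct.tmul_add]
      | tmul c' n' => simp [smul_smul]
  ext n
  have h := congrArg (fun φ => TensorProduct.lid R N (TensorProduct.map
    (LinearMap.mul' R R ∘ₗ TensorProduct.map (β a) (β b)) LinearMap.id (φ n))) hN.1
  simp only [LinearMap.comp_apply, LinearEquiv.coe_coe] at h
  have h' : rAct R β ϱ a n =
    TensorProduct.lid R N (TensorProduct.map (β a) LinearMap.id (ϱ n)) := rfl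
  rw [LinearMap.comp_apply, h', key, h, ← LinearMap.comp_apply (TensorProduct.map _ _),
    ← TensorProduct.map_comp, rAct, hmeas a b]
  rfl

/-- Under the `α`-condition, evaluations at elements of `A` separate the points of
`M ⊗ (C ⊗ N)`. -/
lemma eq_of_forall_eval_eq {β : A →ₗ[R] C →ₗ[R] R}
    (hα : Function.Injective (alphaMap R β (M ⊗[R] N))) {x y : M ⊗[R] (C ⊗[R] N)}
    (h : ∀ a, TensorProduct.map LinearMap.id
        ((TensorProduct.lid R N).toLinearMap ∘ₗ TensorProduct.map (β a) LinearMap.id) x =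
      TensorProduct.map LinearMap.id
        ((TensorProduct.lid R N).toLinearMap ∘ₗ TensorProduct.map (β a) LinearMap.id) y) :
    x = y := by
  let e : M ⊗[R] (C ⊗[R] N) ≃ₗ[R] (M ⊗[R] N) ⊗[R] C :=
    (TensorProduct.congr (LinearEquiv.refl R M) (TensorProduct.comm R C N)).trans
      (TensorProduct.assoc R M N C).symm
  have he (a : A) : (LinearMap.applyₗ a) ∘ₗ alphaMap R β (M ⊗[R] N) ∘ₗ e.toLinearMap =
      TensorProduct.map LinearMap.id
        ((TensorProduct.lid R N).toLinearMap ∘ₗ TensorProduct.map (β a) LinearMap.id) := by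
    ext m c n
    simp [e, alphaMap_tmul]
  refine e.injective (hα (LinearMap.ext fun a => ?_))
  simpa [← he] using h a

/-- The cotensor product is the submodule of `A`-balanced tensors. -/
lemma mem_cotensor_iff {β : A →ₗ[R] C →ₗ[R] R}
    (hα : Function.Injective (alphaMap R β (M ⊗[R] N)))
    (ϱM : M →ₗ[R] M ⊗[R] C) (ϱN : N →ₗ[R] C ⊗[R] N) (x : M ⊗[R] N) :
    x ∈ cotensor R ϱM ϱN ↔ ∀ a, TensorProduct.map (inducedAction R β ϱM a) LinearMap.id x =
      TensorProduct.map LinearMap.id (rAct R β ϱN a) x := by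
  have hl (a : A) : TensorProduct.map LinearMap.id
        ((TensorProduct.lid R N).toLinearMap ∘ₗ TensorProduct.map (β a) LinearMap.id) ∘ₗ
        (TensorProduct.assoc R M C N).toLinearMap ∘ₗ TensorProduct.map ϱM LinearMap.id =
      TensorProduct.map (inducedAction R β ϱM a) LinearMap.id := by
    ext m n
    simp only [TensorProduct.AlgebraTensorModule.curry_apply, LinearMap.restrictScalars_self,
      TensorProduct.curry_apply, LinearMap.comp_apply, LinearEquiv.coe_coe, TensorProduct.map_tmul,
      LinearMap.id_apply, inducedAction_apply]
    induction ϱM m with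
    | zero => simp
    | add x y hx hy => simp only [map_add, hx, hy, TensorProduct.add_tmul]
    | tmul m' c => simp [TensorProduct.smul_tmul]
  have hr (a : A) : TensorProduct.map LinearMap.id
        ((TensorProduct.lid R N).toLinearMap ∘ₗ TensorProduct.map (β a) LinearMap.id) ∘ₗ
        TensorProduct.map LinearMap.id ϱN =
      TensorProduct.map (LinearMap.id : M →ₗ[R] M) (rAct R β ϱN a) := by
    rw [← TensorProduct.map_comp]
    rfl
  simp only [cotensor, LinearMap.mem_ker, LinearMap.sub_apply, sub_eq_zero, ← hl, ← hr]
  exact ⟨fun h a => congrArg _ h, fun h => eq_of_forall_eval_eq hα h⟩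

/-- The operator on `M ⊗ N` by which an element `Σ aᵢ ⊗ bᵢ` of the enveloping algebra acts:
`m ⊗ n ↦ Σ aᵢ m ⊗ n bᵢ`. -/
noncomputable def envelopingAction (β : A →ₗ[R] C →ₗ[R] R)
    (ϱM : M →ₗ[R] M ⊗[R] C) (ϱN : N →ₗ[R] C ⊗[R] N) :
    A ⊗[R] Aᵐᵒᵖ →ₗ[R] M ⊗[R] N →ₗ[R] M ⊗[R] N :=
  TensorProduct.homTensorHomMap (RingHom.id R) M N M N ∘ₗ
    TensorProduct.map (inducedAction R β ϱM) (rActLinear β ϱN)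

lemma envelopingAction_tmul (β : A →ₗ[R] C →ₗ[R] R)
    (ϱM : M →ₗ[R] M ⊗[R] C) (ϱN : N →ₗ[R] C ⊗[R] N) (a b : A) :
    envelopingAction β ϱM ϱN (a ⊗ₜ MulOpposite.op b) =
      TensorProduct.map (inducedAction R β ϱM a) (rAct R β ϱN b) := by
  simp [envelopingAction, rActLinear]

lemma envelopingAction_left_mul [Coalgebra R C] {β : A →ₗ[R] C →ₗ[R] R}
    (hmeas : IsMeasuring R β) {ϱM : M →ₗ[R] M ⊗[R] C} (hM : IsRightComodule R ϱM)
    (ϱN : N →ₗ[R] C ⊗[R] N) (a : A) (e : A ⊗[R] Aᵐᵒᵖ) :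
    envelopingAction β ϱM ϱN ((a ⊗ₜ 1) * e) =
      TensorProduct.map (inducedAction R β ϱM a) LinearMap.id ∘ₗ envelopingAction β ϱM ϱN e := by
  induction e with
  | zero => simp
  | add x y hx hy => simp only [mul_add, map_add, hx, hy, LinearMap.comp_add]
  | tmul x y =>
    obtain ⟨y, rfl⟩ := MulOpposite.op_surjective y
    rw [Algebra.TensorProduct.tmul_mul_tmul, one_mul, envelopingAction_tmul,
      envelopingAction_tmul, inducedAction_mul hmeas hM, ← TensorProduct.map_comp,
      LinearMap.id_comp]

lemma envelopingAction_right_mul [Coalgebra R C] {β : A →ₗ[R] C →ₗ[R] R}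
    (hmeas : IsMeasuring R β) (ϱM : M →ₗ[R] M ⊗[R] C)
    {ϱN : N →ₗ[R] C ⊗[R] N} (hN : IsLeftComodule R ϱN) (a : A) (e : A ⊗[R] Aᵐᵒᵖ) :
    envelopingAction β ϱM ϱN ((1 ⊗ₜ MulOpposite.op a) * e) =
      TensorProduct.map LinearMap.id (rAct R β ϱN a) ∘ₗ envelopingAction β ϱM ϱN e := by
  induction e with
  | zero => simp
  | add x y hx hy => simp only [mul_add, map_add, hx, hy, LinearMap.comp_add]
  | tmul x y =>
    obtain ⟨y, rfl⟩ := MulOpposite.op_surjective y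
    rw [Algebra.TensorProduct.tmul_mul_tmul, one_mul, ← MulOpposite.op_mul,
      envelopingAction_tmul, envelopingAction_tmul, rAct_mul hmeas hN,
      ← TensorProduct.map_comp, LinearMap.id_comp]

/-- On the cotensor product, the enveloping algebra acts through its multiplication map. -/
lemma envelopingAction_of_mem_cotensor [Coalgebra R C] {β : A →ₗ[R] C →ₗ[R] R}
    (hmeas : IsMeasuring R β) (hα : Function.Injective (alphaMap R β (M ⊗[R] N)))
    [Module (A ⊗[R] Aᵐᵒᵖ) A]
    (hsmul : ∀ a b x : A, (a ⊗ₜ[R] (MulOpposite.op b) : A ⊗[R] Aᵐᵒᵖ) • x = a * x * b)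
    {ϱM : M →ₗ[R] M ⊗[R] C} (hM : IsRightComodule R ϱM)
    {ϱN : N →ₗ[R] C ⊗[R] N} (e : A ⊗[R] Aᵐᵒᵖ) {x : M ⊗[R] N}
    (hx : x ∈ cotensor R ϱM ϱN) :
    envelopingAction β ϱM ϱN e x =
      TensorProduct.map (inducedAction R β ϱM (e • (1 : A))) LinearMap.id x := by
  rw [mem_cotensor_iff hα] at hx
  induction e with
  | zero =>
    have h0 : (0 : A ⊗[R] Aᵐᵒᵖ) • (1 : A) = 0 := Module.zero_smul 1
    simp [h0]
  | add y z hy hz =>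
    simp only [add_smul, map_add, hy, hz, LinearMap.add_apply, TensorProduct.map_add_left]
  | tmul a b =>
    obtain ⟨b, rfl⟩ := MulOpposite.op_surjective b
    rw [envelopingAction_tmul, hsmul, mul_one, inducedAction_mul hmeas hM]
    conv_lhs => rw [← LinearMap.comp_id (inducedAction R β ϱM a),
      ← LinearMap.id_comp (rAct R β ϱN b), TensorProduct.map_comp, LinearMap.comp_apply, ← hx b,
      ← LinearMap.comp_apply, ← TensorProduct.map_comp, LinearMap.id_comp]

lemma envelopingAction_natural (β : A →ₗ[R] C →ₗ[R] R) {N' : Type u} [AddCommGroup N']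
    [Module R N'] (ϱM : M →ₗ[R] M ⊗[R] C) {ϱ : N →ₗ[R] C ⊗[R] N} {ϱ' : N' →ₗ[R] C ⊗[R] N'}
    {f : N →ₗ[R] N'} (hf : ϱ' ∘ₗ f = TensorProduct.map LinearMap.id f ∘ₗ ϱ)
    (e : A ⊗[R] Aᵐᵒᵖ) (x : M ⊗[R] N) :
    TensorProduct.map LinearMap.id f (envelopingAction β ϱM ϱ e x) =
      envelopingAction β ϱM ϱ' e (TensorProduct.map LinearMap.id f x) := by
  induction e with
  | zero => simp
  | add y z hy hz => simp only [map_add, LinearMap.add_apply, hy, hz]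
  | tmul a b =>
    obtain ⟨b, rfl⟩ := MulOpposite.op_surjective b
    have hr : f ∘ₗ rAct R β ϱ b = rAct R β ϱ' b ∘ₗ f := by
      have : f ∘ₗ (TensorProduct.lid R N).toLinearMap ∘ₗ TensorProduct.map (β b) LinearMap.id =
          (TensorProduct.lid R N').toLinearMap ∘ₗ TensorProduct.map (β b) LinearMap.id ∘ₗ
            TensorProduct.map LinearMap.id f := by
        ext c n
        simp
      simp only [rAct, LinearMap.comp_assoc, hf]
      simp only [← LinearMap.comp_assoc] at this ⊢
      rw [this]
    simp only [envelopingAction_tmul, ← LinearMap.comp_apply, ← TensorProduct.map_comp, hr,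
      LinearMap.id_comp, LinearMap.comp_id]

/-- A separable algebra has a separability element. -/
lemma exists_separability_element [Module (A ⊗[R] Aᵐᵒᵖ) A]
    (hsmul : ∀ a b x : A, (a ⊗ₜ[R] (MulOpposite.op b) : A ⊗[R] Aᵐᵒᵖ) • x = a * x * b)
    [Module.Projective (A ⊗[R] Aᵐᵒᵖ) A] :
    ∃ e : A ⊗[R] Aᵐᵒᵖ, e • (1 : A) = 1 ∧
      ∀ a : A, (a ⊗ₜ 1) * e = (1 ⊗ₜ MulOpposite.op a) * e := by
  obtain ⟨s, hs⟩ := Module.projective_lifting_property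
    (LinearMap.toSpanSingleton (A ⊗[R] Aᵐᵒᵖ) A 1) LinearMap.id
    (fun a => ⟨a ⊗ₜ MulOpposite.op 1, by
      rw [LinearMap.toSpanSingleton_apply, hsmul, mul_one, mul_one]⟩)
  refine ⟨s 1, by simpa using LinearMap.congr_fun hs 1, fun a => ?_⟩
  rw [← smul_eq_mul, ← smul_eq_mul, ← map_smul, ← map_smul, ← MulOpposite.op_one, hsmul, hsmul]
  simp

/-- The second factor of an `α`-pairing is flat. -/
lemma lTensor_injective_of_alpha {β : A →ₗ[R] C →ₗ[R] R}
    (hα : Function.Injective (alphaMap R β M)) {f : M →ₗ[R] N} (hf : Function.Injective f) :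
    Function.Injective (TensorProduct.map (LinearMap.id : C →ₗ[R] C) f) := by
  have key : alphaMap R β N ∘ₗ (TensorProduct.comm R C N).toLinearMap ∘ₗ
      TensorProduct.map LinearMap.id f =
      LinearMap.compRight R f ∘ₗ alphaMap R β M ∘ₗ (TensorProduct.comm R C M).toLinearMap := by
    ext c m a
    simp [alphaMap_tmul]
  have hinj : Function.Injective (LinearMap.compRight R f ∘ₗ alphaMap R β M ∘ₗ
      (TensorProduct.comm R C M).toLinearMap) := by
    have hcomp : Function.Injective (LinearMap.compRight R f : (A →ₗ[R] M) →ₗ[R] A →ₗ[R] N) :=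
      fun g h hgh => LinearMap.ext fun a => hf (LinearMap.congr_fun hgh a)
    exact hcomp.comp (hα.comp (TensorProduct.comm R C M).injective)
  rw [← key] at hinj
  exact Function.Injective.of_comp (f := alphaMap R β N ∘ₗ (TensorProduct.comm R C N).toLinearMap)
    hinj

end CotensorRetract

section Cofree

variable {R C M V : Type u} [CommRing R] [AddCommGroup C] [Module R C]
  [AddCommGroup M] [Module R M] [AddCommGroup V] [Module R V]

variable (V) in
/-- The canonical map `M ⊗ V → M ⊗ (C ⊗ V)`, whose range is `M □ (C ⊗ V)`. -/
noncomputable def toCofree (ϱM : M →ₗ[R] M ⊗[R] C) : M ⊗[R] V →ₗ[R] M ⊗[R] (C ⊗[R] V) :=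
  (TensorProduct.assoc R M C V).toLinearMap ∘ₗ TensorProduct.map ϱM LinearMap.id

lemma toCofree_natural {W : Type u} [AddCommGroup W] [Module R W] (ϱM : M →ₗ[R] M ⊗[R] C)
    (f : V →ₗ[R] W) (x : M ⊗[R] V) :
    toCofree W ϱM (TensorProduct.map LinearMap.id f x) =
      TensorProduct.map LinearMap.id (TensorProduct.map LinearMap.id f) (toCofree V ϱM x) := by
  induction x with
  | zero => simp
  | add x y hx hy => simp only [map_add, hx, hy]
  | tmul m v =>
    simp only [toCofree, LinearMap.comp_apply, LinearEquiv.coe_coe, TensorProduct.map_tmul,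
      LinearMap.id_apply]
    induction ϱM m with
    | zero => simp
    | add x y hx hy => simp only [map_add, TensorProduct.add_tmul, hx, hy]
    | tmul x y => simp

variable [Coalgebra R C]

variable (R C V) in
/-- The coaction of the cofree left comodule `C ⊗ V`. -/
noncomputable def cofreeCoaction : C ⊗[R] V →ₗ[R] C ⊗[R] (C ⊗[R] V) :=
  (TensorProduct.assoc R C C V).toLinearMap ∘ₗ
    TensorProduct.map (Coalgebra.comul (R := R)) LinearMap.id

lemma IsLeftComodule.injective {ϱ : V →ₗ[R] C ⊗[R] V} (h : IsLeftComodule R ϱ) :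
    Function.Injective ϱ := fun x y hxy => by
  rw [← h.2 x, hxy, h.2 y]

lemma isLeftComodule_cofreeCoaction : IsLeftComodule R (cofreeCoaction R C V) := by
  constructor
  · ext c v
    have key (t : C ⊗[R] C) : (TensorProduct.assoc R C C (C ⊗[R] V)).symm
        (TensorProduct.map LinearMap.id (cofreeCoaction R C V)
          (TensorProduct.assoc R C C V (t ⊗ₜ v))) =
        TensorProduct.assoc R (C ⊗[R] C) C V
          ((TensorProduct.assoc R C C C).symm
            (TensorProduct.map LinearMap.id Coalgebra.comul t) ⊗ₜ v) := by
      induction t with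
      | zero => simp
      | add x y hx hy => simp only [map_add, TensorProduct.add_tmul, hx, hy]
      | tmul x y =>
        simp only [TensorProduct.assoc_tmul, TensorProduct.map_tmul, LinearMap.id_apply,
          cofreeCoaction, LinearMap.comp_apply, LinearEquiv.coe_coe]
        induction (Coalgebra.comul y : C ⊗[R] C) with
        | zero => simp
        | add x y hx hy => simp only [map_add, TensorProduct.add_tmul, TensorProduct.tmul_add,
            hx, hy]
        | tmul p q => simp
    have key' (t : C ⊗[R] C) : TensorProduct.map (Coalgebra.comul (R := R)) LinearMap.id
          (TensorProduct.assoc R C C V (t ⊗ₜ v)) =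
        TensorProduct.assoc R (C ⊗[R] C) C V
          (TensorProduct.map Coalgebra.comul LinearMap.id t ⊗ₜ v) := by
      induction t with
      | zero => simp
      | add x y hx hy => simp only [map_add, TensorProduct.add_tmul, hx, hy]
      | tmul x y => simp
    have hco := Coalgebra.coassoc_symm_apply (R := R) c
    have hd : cofreeCoaction R C V (c ⊗ₜ v) =
      TensorProduct.assoc R C C V (Coalgebra.comul c ⊗ₜ v) := by simp [cofreeCoaction]
    simp only [TensorProduct.AlgebraTensorModule.curry_apply, LinearMap.restrictScalars_self,
      TensorProduct.curry_apply, LinearMap.comp_apply, LinearEquiv.coe_coe, hd, key, key']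
    exact congrArg (fun t => TensorProduct.assoc R (C ⊗[R] C) C V (t ⊗ₜ v)) hco
  · intro x
    induction x with
    | zero => simp
    | add x y hx hy => simp only [map_add, hx, hy]
    | tmul c v =>
      have key (t : C ⊗[R] C) : TensorProduct.lid R (C ⊗[R] V)
          (TensorProduct.map Coalgebra.counit LinearMap.id
            (TensorProduct.assoc R C C V (t ⊗ₜ v))) =
          TensorProduct.lid R C (TensorProduct.map Coalgebra.counit LinearMap.id t) ⊗ₜ v := by
        induction t with
        | zero => simp
        | add x y hx hy => simp only [map_add, TensorProduct.add_tmul, hx, hy]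
        | tmul x y => simp [TensorProduct.smul_tmul']
      have hco := Coalgebra.rTensor_counit_comul (R := R) c
      rw [LinearMap.rTensor] at hco
      simp [cofreeCoaction, key, hco]

lemma cofreeCoaction_natural {W : Type u} [AddCommGroup W] [Module R W] (f : V →ₗ[R] W) :
    cofreeCoaction R C W ∘ₗ TensorProduct.map LinearMap.id f =
      TensorProduct.map LinearMap.id (TensorProduct.map LinearMap.id f) ∘ₗ
        cofreeCoaction R C V := by
  ext c v
  simp only [cofreeCoaction, TensorProduct.AlgebraTensorModule.curry_apply,
    LinearMap.restrictScalars_self, TensorProduct.curry_apply, LinearMap.comp_apply,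
    LinearEquiv.coe_coe, TensorProduct.map_tmul, LinearMap.id_apply]
  induction (Coalgebra.comul c : C ⊗[R] C) with
  | zero => simp
  | add x y hx hy => simp only [map_add, TensorProduct.add_tmul, hx, hy]
  | tmul x y => simp

lemma toCofree_mem_cotensor {ϱM : M →ₗ[R] M ⊗[R] C} (hM : IsRightComodule R ϱM)
    (x : M ⊗[R] V) : toCofree V ϱM x ∈ cotensor R ϱM (cofreeCoaction R C V) := by
  rw [cotensor, LinearMap.mem_ker, LinearMap.sub_apply, sub_eq_zero]
  induction x with
  | zero => simp
  | add x y hx hy => simp only [map_add, hx, hy]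
  | tmul m v =>
    have key (t : M ⊗[R] C) : (TensorProduct.assoc R M C (C ⊗[R] V))
        (TensorProduct.map ϱM LinearMap.id (TensorProduct.assoc R M C V (t ⊗ₜ v))) =
        TensorProduct.map LinearMap.id (TensorProduct.assoc R C C V).toLinearMap
          (TensorProduct.assoc R M (C ⊗[R] C) V
            (TensorProduct.assoc R M C C (TensorProduct.map ϱM LinearMap.id t) ⊗ₜ v)) := by
      induction t with
      | zero => simp
      | add x y hx hy => simp only [map_add, TensorProduct.add_tmul, hx, hy]
      | tmul x y =>
        simp only [TensorProduct.assoc_tmul, TensorProduct.map_tmul, LinearMap.id_apply]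
        induction ϱM x with
        | zero => simp
        | add x y hx hy => simp only [map_add, TensorProduct.add_tmul, hx, hy]
        | tmul p q => simp
    have key' (t : M ⊗[R] C) : TensorProduct.map LinearMap.id (cofreeCoaction R C V)
          (TensorProduct.assoc R M C V (t ⊗ₜ v)) =
        TensorProduct.map LinearMap.id (TensorProduct.assoc R C C V).toLinearMap
          (TensorProduct.assoc R M (C ⊗[R] C) V
            (TensorProduct.map LinearMap.id Coalgebra.comul t ⊗ₜ v)) := by
      induction t with
      | zero => simp
      | add x y hx hy => simp only [map_add, TensorProduct.add_tmul, hx, hy]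
      | tmul x y => simp [cofreeCoaction]
    have h := LinearMap.congr_fun hM.1 m
    simp only [LinearMap.comp_apply, LinearEquiv.coe_coe] at h
    simp only [toCofree, LinearMap.comp_apply, LinearEquiv.coe_coe, TensorProduct.map_tmul,
      LinearMap.id_apply, key, key', h]

lemma toCofree_injective {ϱM : M →ₗ[R] M ⊗[R] C} (hM : IsRightComodule R ϱM) :
    Function.Injective (toCofree V ϱM) := by
  have hϱ : (TensorProduct.rid R M).toLinearMap ∘ₗ
      TensorProduct.map LinearMap.id (Coalgebra.counit (R := R)) ∘ₗ ϱM = LinearMap.id :=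
    LinearMap.ext hM.2
  refine (TensorProduct.assoc R M C V).injective.comp
    (Function.LeftInverse.injective (g := TensorProduct.map ((TensorProduct.rid R M).toLinearMap ∘ₗ
      TensorProduct.map LinearMap.id (Coalgebra.counit (R := R))) LinearMap.id) fun x => ?_)
  rw [← LinearMap.comp_apply, ← TensorProduct.map_comp, LinearMap.comp_assoc, hϱ]
  simp

end Cofree

/-- Let `(A,C)` be a measuring α-pairing with `A` unital and separable
(i.e. `A` is projective as a left module over `A^e = A ⊗ Aᵒᵖ`). Then a right `C`-comodule
`M` is coflat iff `M` is flat as an `R`-module. -/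
theorem coflat_iff_flat
    {R A C M : Type u} [CommRing R]
    [Ring A] [Algebra R A]
    [AddCommGroup C] [Module R C] [Coalgebra R C]
    [AddCommGroup M] [Module R M]
    (β : A →ₗ[R] C →ₗ[R] R)
    (hmeas : IsMeasuring R β)
    (hone : β 1 = Coalgebra.counit (R := R))
    (hα : ∀ (X : Type u) [AddCommGroup X] [Module R X],
      Function.Injective (alphaMap R β X))
    -- `A` is a left `A^e`-module via `(a ⊗ bᵒᵖ) • x = a * x * b` …
    [Module (A ⊗[R] Aᵐᵒᵖ) A]
    (hsmul : ∀ a b x : A, (a ⊗ₜ[R] (MulOpposite.op b) : A ⊗[R] Aᵐᵒᵖ) • x = a * x * b)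
    -- … and `A` is separable: projective over `A^e`
    [Module.Projective (A ⊗[R] Aᵐᵒᵖ) A]
    (ϱM : M →ₗ[R] M ⊗[R] C) (hM : IsRightComodule R ϱM)
    (hMinj : Function.Injective ϱM) :
    IsCoflat R ϱM ↔ Module.Flat R M := by
  constructor
  · intro hco
    rw [Module.Flat.iff_lTensor_preserves_injective_linearMap]
    intro V W _ _ _ _ f hf
    rw [injective_iff_map_eq_zero]
    intro x hx
    let g := (LinearMap.range f).mkQ
    have hexact : Function.Exact f g := LinearMap.exact_map_mkQ_range f
    have hg : Function.Surjective g := Submodule.mkQ_surjective _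
    have hCexact := (lTensor_exact C hexact hg).linearMap_ker_eq
    have hinj := (hco _ _ _ _ _ _ isLeftComodule_cofreeCoaction
      isLeftComodule_cofreeCoaction.injective isLeftComodule_cofreeCoaction
      isLeftComodule_cofreeCoaction.injective isLeftComodule_cofreeCoaction
      isLeftComodule_cofreeCoaction.injective _ _ (cofreeCoaction_natural f)
      (cofreeCoaction_natural g) (lTensor_injective_of_alpha (hα V) hf)
      (LinearMap.lTensor_surjective C hg) hCexact.symm).1
    refine toCofree_injective hM ?_
    refine hinj _ (toCofree_mem_cotensor hM x) _ (toCofree_mem_cotensor hM 0) ?_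
    rw [← toCofree_natural, ← toCofree_natural]
    exact congrArg _ (hx.trans (map_zero _).symm)
  · intro hflat N₁ N₂ N₃ _ _ _ _ _ _ ϱ₁ ϱ₂ ϱ₃ h₁ _ h₂ _ h₃ _ f g hf hg hfinj hgsurj hfg
    obtain ⟨e, he, hcomm⟩ := exists_separability_element (R := R) (A := A) hsmul
    have hmem {N : Type u} [AddCommGroup N] [Module R N] {ϱ : N →ₗ[R] C ⊗[R] N}
        (hN : IsLeftComodule R ϱ) (x : M ⊗[R] N) :
        envelopingAction β ϱM ϱ e x ∈ cotensor R ϱM ϱ := by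
      rw [mem_cotensor_iff (hα _)]
      intro a
      rw [← LinearMap.comp_apply, ← envelopingAction_left_mul hmeas hM, hcomm,
        envelopingAction_right_mul hmeas ϱM hN, LinearMap.comp_apply]
    have hfix {N : Type u} [AddCommGroup N] [Module R N] {ϱ : N →ₗ[R] C ⊗[R] N}
        {x : M ⊗[R] N} (hx : x ∈ cotensor R ϱM ϱ) : envelopingAction β ϱM ϱ e x = x := by
      rw [envelopingAction_of_mem_cotensor hmeas (hα _) hsmul hM e hx, he,
        inducedAction_one hone hM, TensorProduct.map_id, LinearMap.id_apply]
    have hexact := lTensor_exact M (LinearMap.exact_iff.mpr hfg.symm) hgsurj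
    refine ⟨fun x _ y _ hxy => ?_, fun y hy hgy => ?_, fun z hz => ?_⟩
    · exact Module.Flat.lTensor_preserves_injective_linearMap f hfinj hxy
    · obtain ⟨x, rfl⟩ := (hexact y).mp hgy
      exact ⟨_, hmem h₁ x, (envelopingAction_natural β ϱM hf e x).trans (hfix hy)⟩
    · obtain ⟨y, rfl⟩ := LinearMap.lTensor_surjective M hgsurj z
      exact ⟨_, hmem h₂ y, (envelopingAction_natural β ϱM hg e y).trans (hfix hz)⟩
end

section
/- Let R be a Noetherian commutative ring and H an R-bialgebra. Then: (i) Ker(ε_H) is an R-cofinite ideal of H; (ii) for all R-cofinite ideals I, J ⊲ H there exists an R-cofinite ideal L ⊲ H with Δ_H(L) ⊆ Im(ι_I⊗id_H) + Im(id_H⊗ι_J) (the image of I⊗_R H plus the image of H⊗_R J inside H⊗_R H); (iii) if H is moreover a Hopf R-algebra with antipode S_H, then for every R-cofinite ideal I ⊲ H there exists an R-cofinite ideal J ⊲ H with S_H(J) ⊆ I. In the terminology of the paper: over a Noetherian ring, every R-bialgebra (respectively Hopf R-algebra) is quasi-admissible. -/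
open TensorProduct

universe u

/-- The quotient by the kernel of a linear map into a Noetherian module is finite. -/
theorem Module.Finite.quotient_of_eq_ker {R M N : Type*} [Ring R] [AddCommGroup M] [Module R M]
    [AddCommGroup N] [Module R N] [IsNoetherian R N] (f : M →ₗ[R] N) {K : Submodule R M}
    (hK : K = LinearMap.ker f) : Module.Finite R (M ⧸ K) := by
  subst hK
  exact Module.Finite.equiv f.quotKerEquivRange.symm

/-- Let `R` be Noetherian and `H` an `R`-bialgebra. Then (i) `Ker ε_H`
is an `R`-cofinite (two-sided) ideal of `H`; (ii) for all `R`-cofinite two-sided ideals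
`I, J ⊴ H` there is an `R`-cofinite two-sided ideal `L ⊴ H` with
`Δ(L) ⊆ Im(ι_I ⊗ id) + Im(id ⊗ ι_J)`; (iii) if `H` has an antipode `S` (is a Hopf
algebra), then for every `R`-cofinite two-sided ideal `I ⊴ H` there is an `R`-cofinite
two-sided ideal `J ⊴ H` with `S(J) ⊆ I`. That is, over a Noetherian ring every
`R`-bialgebra (Hopf `R`-algebra) is quasi-admissible. -/
theorem bialgebra_quasiAdmissible
    {R H : Type u} [CommRing R] [IsNoetherianRing R] [Ring H] [Bialgebra R H] :
    -- (i)
    ((∀ x ∈ LinearMap.ker (Coalgebra.counit (R := R) (A := H)), ∀ b : H,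
        b * x ∈ LinearMap.ker (Coalgebra.counit (R := R) (A := H))
        ∧ x * b ∈ LinearMap.ker (Coalgebra.counit (R := R) (A := H)))
      ∧ Module.Finite R (H ⧸ LinearMap.ker (Coalgebra.counit (R := R) (A := H))))
    ∧
    -- (ii)
    (∀ I J : Ideal H,
      (∀ x ∈ I, ∀ b : H, x * b ∈ I) →
      Module.Finite R (H ⧸ Submodule.restrictScalars R I) →
      (∀ x ∈ J, ∀ b : H, x * b ∈ J) →
      Module.Finite R (H ⧸ Submodule.restrictScalars R J) →
      ∃ L : Ideal H,
        (∀ x ∈ L, ∀ b : H, x * b ∈ L)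
        ∧ Module.Finite R (H ⧸ Submodule.restrictScalars R L)
        ∧ ∀ x ∈ L, Coalgebra.comul (R := R) x ∈
            LinearMap.range (TensorProduct.map
              (Submodule.restrictScalars R I).subtype (LinearMap.id : H →ₗ[R] H))
            ⊔ LinearMap.range (TensorProduct.map
              (LinearMap.id : H →ₗ[R] H) (Submodule.restrictScalars R J).subtype))
    ∧
    -- (iii)
    (∀ S : H →ₗ[R] H,
      ((LinearMap.mul' R H) ∘ₗ (TensorProduct.map S LinearMap.id) ∘ₗ
          (Coalgebra.comul (R := R))
        = (Algebra.linearMap R H) ∘ₗ (Coalgebra.counit (R := R))) →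
      ((LinearMap.mul' R H) ∘ₗ (TensorProduct.map LinearMap.id S) ∘ₗ
          (Coalgebra.comul (R := R))
        = (Algebra.linearMap R H) ∘ₗ (Coalgebra.counit (R := R))) →
      ∀ I : Ideal H,
        (∀ x ∈ I, ∀ b : H, x * b ∈ I) →
        Module.Finite R (H ⧸ Submodule.restrictScalars R I) →
        ∃ J : Ideal H,
          (∀ x ∈ J, ∀ b : H, x * b ∈ J)
          ∧ Module.Finite R (H ⧸ Submodule.restrictScalars R J)
          ∧ ∀ x ∈ J, S x ∈ I) := by
  refine ⟨⟨fun x hx b => ?_, Module.Finite.quotient_of_eq_ker _ rfl⟩,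
    fun I J hI hIfin hJ hJfin => ?_, fun S hS_left hS_right I hI hIfin => ?_⟩
  · rw [LinearMap.mem_ker] at hx
    simp [LinearMap.mem_ker, Bialgebra.counit_mul, hx]
  · have : I.IsTwoSided := ⟨fun b hx => hI _ hx b⟩
    have : J.IsTwoSided := ⟨fun b hx => hJ _ hx b⟩
    have : Module.Finite R (H ⧸ I) := hIfin
    have : Module.Finite R (H ⧸ J) := hJfin
    let f : H →ₐ[R] (H ⧸ I) ⊗[R] (H ⧸ J) :=
      (Algebra.TensorProduct.map (Ideal.Quotient.mkₐ R I) (Ideal.Quotient.mkₐ R J)).comp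
        (Bialgebra.comulAlgHom R H)
    refine ⟨RingHom.ker f, fun x hx b => Ideal.mul_mem_right b _ hx,
      Module.Finite.quotient_of_eq_ker f.toLinearMap rfl, fun x hx => ?_⟩
    have h_ker := TensorProduct.map_ker
      (f := (Submodule.restrictScalars R I).subtype)
      (g := (Submodule.restrictScalars R I).mkQ)
      (f' := (Submodule.restrictScalars R J).subtype)
      (g' := (Submodule.restrictScalars R J).mkQ)
      (LinearMap.exact_subtype_mkQ _) (Submodule.mkQ_surjective _)
      (LinearMap.exact_subtype_mkQ _) (Submodule.mkQ_surjective _)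
    rw [sup_comm]
    exact h_ker.le hx
  · let : HopfAlgebra R H :=
      { antipode := S
        mul_antipode_rTensor_comul := hS_left
        mul_antipode_lTensor_comul := hS_right }
    have hS_mul (a b : H) : S (a * b) = S b * S a := HopfAlgebra.antipode_mul_antidistrib a b
    have : Module.Finite R (H ⧸ Submodule.restrictScalars R I) := hIfin
    let J : Ideal H :=
      { (Submodule.restrictScalars R I).comap S with
        smul_mem' := fun b x hx => by
          change S (b * x) ∈ I
          rw [hS_mul]
          exact hI _ hx _ }
    refine ⟨J, fun x hx b => ?_, ?_, fun x hx => hx⟩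
    · change S (x * b) ∈ I
      rw [hS_mul]
      exact I.mul_mem_left _ hx
    · refine Module.Finite.quotient_of_eq_ker ((Submodule.restrictScalars R I).mkQ ∘ₗ S) ?_
      rw [LinearMap.ker_comp, Submodule.ker_mkQ]
      rfl
end
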